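/- Let R(X, Y)Z := λ² Σ_{i=1}^{3} Hᵢ(X, Y)·HᵢZ be the curvature of the canonical connection of n_p and define its Ricci tensor by Ric(X, Y) := Σ_a g_λ(R(e_a, X)Y, e_a), where (e_a) is the orthonormal basis ξ₁, ξ₂, ξ₃, τ₁, …, τ_{4p}. Then Ric is diagonal in this basis with Ric(ξᵢ, ξᵢ) = −8λ² for i = 1, 2, 3 and Ric(τₗ, τₗ) = −3λ² for l = 1, …, 4p, and all off-diagonal entries vanish. -/

import Mathlib

/-! Common setup: the quaternionic Heisenberg Lie algebra `n_p` of dimension `4p+3`,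
realised as `ℝ^{4p+3}` with orthonormal basis `ξ₁ ξ₂ ξ₃ τ₁ … τ_{4p}`. -/

noncomputable section

open scoped BigOperators

/-- The underlying vector space of the quaternionic Heisenberg Lie algebra `n_p`. -/
abbrev NV (p : ℕ) : Type := Fin (4 * p + 3) → ℝ

/-- The inner product `g_λ` for which the standard basis is orthonormal. -/
def gIP {p : ℕ} (X Y : NV p) : ℝ := ∑ a, X a * Y a

/-- Index of the basis vector `ξ_{i+1}`, `i = 0, 1, 2`. -/
def zI (p : ℕ) (i : Fin 3) : Fin (4 * p + 3) := ⟨i.val, by have := i.isLt; omega⟩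

/-- Index of the basis vector `τ_{ip + r + 1}`, `i = 0, 1, 2, 3`, `r = 0, …, p-1`. -/
def tI (p : ℕ) (i : Fin 4) (r : Fin p) : Fin (4 * p + 3) :=
  ⟨3 + i.val * p + r.val, by
    have h1 := i.isLt; have h2 := r.isLt
    have h3 : i.val * p ≤ 3 * p := Nat.mul_le_mul_right p (by omega)
    omega⟩

/-- The basis vector `ξ_{i+1}`. -/
def xi (p : ℕ) (i : Fin 3) : NV p := Pi.single (zI p i) 1

/-- The basis vector `τ_{ip + r + 1}`. -/
def tau (p : ℕ) (i : Fin 4) (r : Fin p) : NV p := Pi.single (tI p i r) 1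

/-- The Lie bracket of `n_p`: the bilinear extension of
`[τ_r, τ_{p+r}] = [τ_{2p+r}, τ_{3p+r}] = λ ξ₁`, `[τ_r, τ_{2p+r}] = [τ_{3p+r}, τ_{p+r}] = λ ξ₂`,
`[τ_r, τ_{3p+r}] = [τ_{p+r}, τ_{2p+r}] = λ ξ₃`, all other brackets of basis vectors being zero. -/
def bracket (p : ℕ) (lam : ℝ) (X Y : NV p) : NV p :=
  (lam * ∑ r : Fin p,
      (X (tI p 0 r) * Y (tI p 1 r) - X (tI p 1 r) * Y (tI p 0 r)
        + X (tI p 2 r) * Y (tI p 3 r) - X (tI p 3 r) * Y (tI p 2 r))) • xi p 0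
  + (lam * ∑ r : Fin p,
      (X (tI p 0 r) * Y (tI p 2 r) - X (tI p 2 r) * Y (tI p 0 r)
        + X (tI p 3 r) * Y (tI p 1 r) - X (tI p 1 r) * Y (tI p 3 r))) • xi p 1
  + (lam * ∑ r : Fin p,
      (X (tI p 0 r) * Y (tI p 3 r) - X (tI p 3 r) * Y (tI p 0 r)
        + X (tI p 1 r) * Y (tI p 2 r) - X (tI p 2 r) * Y (tI p 1 r))) • xi p 2

/-- `dη_i(X, Y) := -η_i([X, Y])`. -/
def dEta (p : ℕ) (lam : ℝ) (i : Fin 3) (X Y : NV p) : ℝ := -(bracket p lam X Y (zI p i))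

/-- The three almost contact endomorphisms `φ₁, φ₂, φ₃` of `n_p`. -/
def phi (p : ℕ) : Fin 3 → NV p → NV p :=
  ![fun X => X (zI p 1) • xi p 2 - X (zI p 2) • xi p 1
      + ∑ r : Fin p, (X (tI p 0 r) • tau p 1 r - X (tI p 1 r) • tau p 0 r
          + X (tI p 2 r) • tau p 3 r - X (tI p 3 r) • tau p 2 r),
    fun X => X (zI p 2) • xi p 0 - X (zI p 0) • xi p 2
      + ∑ r : Fin p, (X (tI p 0 r) • tau p 2 r - X (tI p 2 r) • tau p 0 r
          + X (tI p 3 r) • tau p 1 r - X (tI p 1 r) • tau p 3 r),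
    fun X => X (zI p 0) • xi p 1 - X (zI p 1) • xi p 0
      + ∑ r : Fin p, (X (tI p 0 r) • tau p 3 r - X (tI p 3 r) • tau p 0 r
          + X (tI p 1 r) • tau p 2 r - X (tI p 2 r) • tau p 1 r)]

/-- `(η_i ∧ η_j)(X, Y)`. -/
def etaWedge (p : ℕ) (i j : Fin 3) (X Y : NV p) : ℝ :=
  X (zI p i) * Y (zI p j) - Y (zI p i) * X (zI p j)

/-- The 2-forms `H₁ = -(1/λ)dη₁ + 2 η₂∧η₃`, `H₂ = -(1/λ)dη₂ - 2 η₁∧η₃`,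
`H₃ = -(1/λ)dη₃ + 2 η₁∧η₂`. -/
def Hform (p : ℕ) (lam : ℝ) : Fin 3 → NV p → NV p → ℝ :=
  ![fun X Y => -(1 / lam) * dEta p lam 0 X Y + 2 * etaWedge p 1 2 X Y,
    fun X Y => -(1 / lam) * dEta p lam 1 X Y - 2 * etaWedge p 0 2 X Y,
    fun X Y => -(1 / lam) * dEta p lam 2 X Y + 2 * etaWedge p 0 1 X Y]

/-- The 2-form `H_i` regarded as an endomorphism of `n_p` via `g_λ(H_i X, Y) = H_i(X, Y)`. -/
def Hend (p : ℕ) (lam : ℝ) (i : Fin 3) (X : NV p) : NV p :=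
  fun b => Hform p lam i X (Pi.single b 1)

/-- `(η₁ ∧ η₂ ∧ η₃)(X, Y, Z)`. -/
def det3 (p : ℕ) (X Y Z : NV p) : ℝ :=
  X (zI p 0) * (Y (zI p 1) * Z (zI p 2) - Y (zI p 2) * Z (zI p 1))
  - Y (zI p 0) * (X (zI p 1) * Z (zI p 2) - X (zI p 2) * Z (zI p 1))
  + Z (zI p 0) * (X (zI p 1) * Y (zI p 2) - X (zI p 2) * Y (zI p 1))

/-- The torsion 3-form `T = η₁∧dη₁ + η₂∧dη₂ + η₃∧dη₃ - 4λ η₁∧η₂∧η₃`. -/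
def Tform (p : ℕ) (lam : ℝ) (X Y Z : NV p) : ℝ :=
  (∑ i : Fin 3,
    (X (zI p i) * dEta p lam i Y Z - Y (zI p i) * dEta p lam i X Z
      + Z (zI p i) * dEta p lam i X Y)) - 4 * lam * det3 p X Y Z

/-- The standard basis vector `e_a` of `n_p`. -/
def basisE (p : ℕ) (a : Fin (4 * p + 3)) : NV p := Pi.single a 1

end

/-- The curvature operator `R(X,Y)Z = λ² Σᵢ Hᵢ(X,Y)·HᵢZ` of the canonical connection. -/
noncomputable def Rop (p : ℕ) (lam : ℝ) (X Y Z : NV p) : NV p :=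
  lam ^ 2 • ∑ i : Fin 3, Hform p lam i X Y • Hend p lam i Z

/-- Its Ricci tensor `Ric(X,Y) = Σₐ g_λ(R(eₐ, X)Y, eₐ)`. -/
noncomputable def RicT (p : ℕ) (lam : ℝ) (X Y : NV p) : ℝ :=
  ∑ a, gIP (Rop p lam (basisE p a) X Y) (basisE p a)

theorem zI_injective (p : ℕ) : Function.Injective (zI p) := fun _ _ h =>
  Fin.ext (Fin.mk.inj h)

theorem zI_ne_tI (p : ℕ) (i : Fin 3) (j : Fin 4) (r : Fin p) : zI p i ≠ tI p j r := by
  intro h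
  have := congrArg Fin.val h
  simp only [zI, tI] at this
  omega

theorem tI_inj (p : ℕ) {i j : Fin 4} {r s : Fin p} : tI p i r = tI p j s ↔ i = j ∧ r = s := by
  refine ⟨fun h => ?_, fun h => by rw [h.1, h.2]⟩
  have h := congrArg Fin.val h
  simp only [tI] at h
  have hr := r.isLt
  have hs := s.isLt
  rw [Fin.ext_iff (a := r)]
  fin_cases i <;> fin_cases j <;> simp at h ⊢ <;> omega

/-- The enumeration of the basis of `n_p` by the vectors `ξ_i` and `τ_{ip + r}`. -/
def basisIndex (p : ℕ) : Fin 3 ⊕ Fin 4 × Fin p → Fin (4 * p + 3) :=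
  Sum.elim (zI p) fun q => tI p q.1 q.2

theorem basisIndex_bijective (p : ℕ) : Function.Bijective (basisIndex p) := by
  refine (Fintype.bijective_iff_injective_and_card _).2 ⟨?_, by simp; omega⟩
  refine (zI_injective p).sumElim (fun q q' h => Prod.ext_iff.2 ((tI_inj p).1 h))
    fun i q => zI_ne_tI p i q.1 q.2

theorem sum_eq_sum_zI_add_sum_tI (p : ℕ) (f : Fin (4 * p + 3) → ℝ) :
    ∑ a, f a = ∑ i, f (zI p i) + ∑ i, ∑ r, f (tI p i r) := by
  rw [← (basisIndex_bijective p).sum_comp f, Fintype.sum_sum_type, Fintype.sum_prod_type]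
  rfl

theorem Hform_swap (p : ℕ) (lam : ℝ) (i : Fin 3) (X Y : NV p) :
    Hform p lam i X Y = -Hform p lam i Y X := by
  fin_cases i <;>
  · simp [Hform, dEta, bracket, etaWedge, xi, (zI_injective p).eq_iff,
      Finset.sum_add_distrib, Finset.sum_sub_distrib, mul_comm]
    ring

theorem Hform_single_zI (p : ℕ) (lam : ℝ) (Y : NV p) (i k : Fin 3) :
    Hform p lam i Y (Pi.single (zI p k) 1) =
      2 * (![![0, -Y (zI p 2), Y (zI p 1)],
        ![Y (zI p 2), 0, -Y (zI p 0)],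
        ![-Y (zI p 1), Y (zI p 0), 0]] i k) := by
  fin_cases i <;> fin_cases k <;>
    simp [Hform, dEta, bracket, etaWedge, xi, (zI_injective p).eq_iff,
      (zI_ne_tI p _ _ _).symm]

theorem Hform_single_tI (p : ℕ) {lam : ℝ} (hlam : lam ≠ 0) (Y : NV p) (i : Fin 3) (k : Fin 4)
    (s : Fin p) :
    Hform p lam i Y (Pi.single (tI p k s) 1) =
      ![![-Y (tI p 1 s), -Y (tI p 2 s), -Y (tI p 3 s)],
        ![Y (tI p 0 s), Y (tI p 3 s), -Y (tI p 2 s)],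
        ![-Y (tI p 3 s), Y (tI p 0 s), Y (tI p 1 s)],
        ![Y (tI p 2 s), -Y (tI p 1 s), Y (tI p 0 s)]] k i := by
  fin_cases i <;> fin_cases k <;>
    simp [Hform, dEta, bracket, etaWedge, xi, (zI_injective p).eq_iff, Pi.single_apply,
      zI_ne_tI, tI_inj, hlam]

theorem RicT_eq_neg_sum (p : ℕ) (lam : ℝ) (X Y : NV p) :
    RicT p lam X Y = -lam ^ 2 * ∑ a, ∑ i,
      Hform p lam i X (Pi.single a 1) * Hform p lam i Y (Pi.single a 1) := by
  rw [RicT, Finset.mul_sum]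
  refine Finset.sum_congr rfl fun a _ => ?_
  simp only [gIP, basisE, Pi.single_apply, mul_ite, mul_one, mul_zero, Finset.sum_ite_eq',
    Finset.mem_univ, if_true, Rop, Pi.smul_apply, Finset.sum_apply, smul_eq_mul, Hend,
    Hform_swap p lam _ (Pi.single a 1) X, neg_mul, Finset.sum_neg_distrib, mul_neg]

theorem RicT_eq (p : ℕ) {lam : ℝ} (hlam : lam ≠ 0) (X Y : NV p) :
    RicT p lam X Y = -8 * lam ^ 2 * ∑ i, X (zI p i) * Y (zI p i)
      + -3 * lam ^ 2 * ∑ i, ∑ r, X (tI p i r) * Y (tI p i r) := by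
  rw [RicT_eq_neg_sum, sum_eq_sum_zI_add_sum_tI]
  simp only [Hform_single_zI, Hform_single_tI p hlam]
  simp [Fin.sum_univ_succ, Finset.sum_add_distrib]
  ring

/-- the Ricci tensor of the canonical connection is diagonal with
`Ric(ξᵢ, ξᵢ) = -8λ²` and `Ric(τₗ, τₗ) = -3λ²`, all off-diagonal entries vanishing. -/
theorem quaternionic_heisenberg_Ricci_diagonal
    (p : ℕ) (hp : 1 ≤ p) (lam : ℝ) (hlam : 0 < lam) :
    (∀ i : Fin 3, RicT p lam (xi p i) (xi p i) = -8 * lam ^ 2) ∧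
    (∀ (i : Fin 4) (r : Fin p), RicT p lam (tau p i r) (tau p i r) = -3 * lam ^ 2) ∧
    (∀ a b : Fin (4 * p + 3), a ≠ b → RicT p lam (basisE p a) (basisE p b) = 0) := by
  have h := fun X Y => RicT_eq p hlam.ne' X Y
  refine ⟨fun i => ?_, fun i r => ?_, fun a b hab => ?_⟩
  · simp [h, xi, Pi.single_apply, (zI_injective p).eq_iff, (zI_ne_tI p _ _ _).symm]
  · simp [h, tau, Pi.single_apply, tI_inj, zI_ne_tI, ite_and]
  · have hz : ∀ c, basisE p a c * basisE p b c = 0 := fun c => by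
      by_cases hc : c = a
      · simp [basisE, hc, hab]
      · simp [basisE, Pi.single_apply, hc]
    simp [h, hz]
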